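/- There are no positive integers n, m, l, a such that α^n + α^m + α^l = 2^a · √5, where α = (1+√5)/2 is the golden ratio. -/

import Mathlib

theorem half_one_add_sqrt_five_pow_succ (k : ℕ) :
    ((1 + Real.sqrt 5) / 2) ^ (k + 1) =
      Nat.fib (k + 1) * ((1 + Real.sqrt 5) / 2) + Nat.fib k := by
  have h5 : Real.sqrt 5 ^ 2 = 5 := Real.sq_sqrt (by norm_num)
  induction k with
  | zero => simp
  | succ k ih =>
    rw [pow_succ, ih, Nat.fib_add_two]
    push_cast
    linear_combination (Nat.fib (k + 1) : ℝ) / 4 * h5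

theorem no_three_golden_powers_eq_pow_two_mul_sqrt_five :
    ¬ ∃ n m l a : ℕ, 0 < n ∧ 0 < m ∧ 0 < l ∧ 0 < a ∧
      ((1 + Real.sqrt 5) / 2) ^ n + ((1 + Real.sqrt 5) / 2) ^ m +
        ((1 + Real.sqrt 5) / 2) ^ l = 2 ^ a * Real.sqrt 5 := by
  rintro ⟨n, m, l, a, hn, hm, hl, -, h⟩
  obtain ⟨n, rfl⟩ := Nat.exists_eq_add_one.mpr hn
  obtain ⟨m, rfl⟩ := Nat.exists_eq_add_one.mpr hm
  obtain ⟨l, rfl⟩ := Nat.exists_eq_add_one.mpr hl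
  simp only [half_one_add_sqrt_five_pow_succ] at h
  set A : ℕ := Nat.fib (n + 1) + Nat.fib (m + 1) + Nat.fib (l + 1) with hA
  set B : ℕ := Nat.fib n + Nat.fib m + Nat.fib l with hB
  have hpos : 0 < A := by
    have : 0 < Nat.fib (n + 1) := Nat.fib_pos.mpr n.succ_pos
    omega
  have key : ((2 ^ (a + 1) - A : ℤ) : ℝ) * Real.sqrt 5 = ((A + 2 * B : ℕ) : ℝ) := by
    rw [hA, hB]
    push_cast
    linear_combination -2 * h
  have hne : (2 ^ (a + 1) - A : ℤ) ≠ 0 := by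
    intro h0
    rw [h0, Int.cast_zero, zero_mul] at key
    have : A + 2 * B = 0 := by exact_mod_cast key.symm
    omega
  have hirr : Irrational (Real.sqrt 5) := by
    simpa using Nat.Prime.irrational_sqrt (show Nat.Prime 5 by norm_num)
  exact (hirr.intCast_mul hne).ne_nat _ key
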